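/- arXiv:1907.00598 — 13 statements merged into one kernel-verified Lean document; each statement's English description precedes it below -/
import Mathlib

section
/- Let F_q be a finite field, and let E be a T×K matrix over F_q that satisfies the single-message PIR-SI condition with side-information size M (i.e., for every i ∈ {1,…,K} there exists a set S ⊆ {1,…,K}\{i} with |S| ≤ M such that e_i lies in the span of the rows of E together with the unit vectors e_j, j ∈ S). Then the dual code C = {x ∈ F_q^K : Ex = 0} has all-symbol locality M: for every i ∈ {1,…,K} there exist a set R ⊆ {1,…,K}\{i} with |R| ≤ M and coefficients λ_l ∈ F_q (l ∈ R) such that x_i = Σ_{l∈R} λ_l x_l for every x ∈ C. -/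
/-- The span of the rows of `E` together with the unit vectors `e_j`, `j ∈ S`. -/
def rowUnitSpan (F : Type*) [Field F] {T K : ℕ} (E : Matrix (Fin T) (Fin K) F)
    (S : Finset (Fin K)) : Submodule F (Fin K → F) :=
  Submodule.span F
    (Set.range (fun t => E t) ∪ (fun j => Pi.single j (1 : F)) '' (S : Set (Fin K)))

/-- On the kernel of `E`, pairing with an element of `rowUnitSpan F E S` depends only on the
coordinates in `S`, linearly. -/
theorem exists_dotProduct_eq_sum_of_mem_rowUnitSpan {F : Type*} [Field F] {T K : ℕ}
    {E : Matrix (Fin T) (Fin K) F} {S : Finset (Fin K)} {v : Fin K → F}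
    (hv : v ∈ rowUnitSpan F E S) :
    ∃ lam : Fin K → F, ∀ x : Fin K → F, E.mulVec x = 0 →
      v ⬝ᵥ x = ∑ l ∈ S, lam l * x l := by
  induction hv using Submodule.span_induction with
  | mem v hv =>
    rcases hv with ⟨t, rfl⟩ | ⟨j, hj, rfl⟩
    · exact ⟨0, fun x hx => (congrFun hx t).trans (by simp)⟩
    · refine ⟨Pi.single j 1, fun x _ => ?_⟩
      rw [Finset.sum_eq_single_of_mem j hj fun l _ hl => by simp [hl]]
      simp
  | zero => exact ⟨0, by simp⟩
  | add v w _ _ ihv ihw =>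
    obtain ⟨a, ha⟩ := ihv
    obtain ⟨b, hb⟩ := ihw
    exact ⟨a + b, fun x hx => by
      simp [add_dotProduct, ha x hx, hb x hx, add_mul, Finset.sum_add_distrib]⟩
  | smul c v _ ih =>
    obtain ⟨a, ha⟩ := ih
    exact ⟨c • a, fun x hx => by simp [ha x hx, Finset.mul_sum, mul_assoc]⟩

/-- Theorem 1: any scalar-linear solution `E` to the single-message PIR-SI problem
(with side-information size `M`) is a parity check matrix of an LRC with block-length `K`
and all-symbol locality `M`. -/
theorem smPirSi_dual_is_LRC (F : Type*) [Field F] [Fintype F] {T K M : ℕ}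
    (E : Matrix (Fin T) (Fin K) F)
    (hE : ∀ i : Fin K, ∃ S : Finset (Fin K), i ∉ S ∧ S.card ≤ M ∧
      (Pi.single i 1 : Fin K → F) ∈ rowUnitSpan F E S) :
    ∀ i : Fin K, ∃ (R : Finset (Fin K)) (lam : Fin K → F), i ∉ R ∧ R.card ≤ M ∧
      ∀ x : Fin K → F, E.mulVec x = 0 → x i = ∑ l ∈ R, lam l * x l := by
  intro i
  obtain ⟨S, hiS, hS, hi⟩ := hE i
  obtain ⟨lam, hlam⟩ := exists_dotProduct_eq_sum_of_mem_rowUnitSpan hi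
  exact ⟨S, lam, hiS, hS, fun x hx => by simpa using hlam x hx⟩
end

section
/- Let F_q be a finite field, K ≥ 1, and let E be a T×K matrix over F_q that satisfies the single-message PIR-SI condition with side-information size M (i.e., for every i ∈ {1,…,K} there exists a set S ⊆ {1,…,K}\{i} with |S| ≤ M such that e_i lies in the span of the rows of E together with the unit vectors e_j, j ∈ S). Then T ≥ ⌈K/(M+1)⌉. (Equivalently, the scalar-linear capacity of the single-message PIR-SI problem is at most 1/⌈K/(M+1)⌉.) -/
/-- A vector in the span of the unit vectors indexed by `S` vanishes outside `S`. -/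
theorem apply_eq_zero_of_mem_span_single {F ι : Type*} [Semiring F] [DecidableEq ι] {S : Set ι}
    {z : ι → F} (hz : z ∈ Submodule.span F ((fun j => Pi.single j (1 : F)) '' S))
    {j : ι} (hj : j ∉ S) : z j = 0 := by
  have hle : Submodule.span F ((fun j => Pi.single j (1 : F)) '' S) ≤
      LinearMap.ker (LinearMap.proj j : (ι → F) →ₗ[F] F) := by
    rw [Submodule.span_le]
    rintro _ ⟨k, hk, rfl⟩
    have hjk : j ≠ k := fun h => hj (h ▸ hk)
    simp [hjk]
  exact hle hz

/-- If `e_i` is recoverable from `E` with side information `S`, the row space of `E` contains a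
vector that is nonzero at `i` and supported on `insert i S`. -/
theorem exists_mem_span_rows_of_single_mem_rowUnitSpan {F : Type*} [Field F] {T K : ℕ}
    {E : Matrix (Fin T) (Fin K) F} {S : Finset (Fin K)} {i : Fin K} (hi : i ∉ S)
    (h : (Pi.single i 1 : Fin K → F) ∈ rowUnitSpan F E S) :
    ∃ y ∈ Submodule.span F (Set.range fun t => E t), y i ≠ 0 ∧ ∀ j, y j ≠ 0 → j ∈ insert i S := by
  rw [rowUnitSpan, Submodule.span_union, Submodule.mem_sup] at h
  obtain ⟨y, hy, z, hz, hyz⟩ := h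
  have key : ∀ j ∉ S, y j = (Pi.single i 1 : Fin K → F) j := fun j hj => by
    rw [← hyz, Pi.add_apply, apply_eq_zero_of_mem_span_single hz (by simpa using hj), add_zero]
  refine ⟨y, hy, by simp [key i hi], fun j hj => ?_⟩
  by_contra hji
  rw [Finset.mem_insert, not_or] at hji
  exact hj (by simp [key j hji.2, hji.1])

/-- If every coordinate is nonzero on some vector of a family whose members have at most `n`
nonzero coordinates, then the number of coordinates is at most `n` times the dimension of the
span of the family. -/
theorem card_le_finrank_span_mul {F ι κ : Type*} [Field F] [DecidableEq F] [Fintype ι] {n : ℕ}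
    (v : κ → ι → F) (hv : ∀ k, (Finset.univ.filter fun j => v k j ≠ 0).card ≤ n)
    (hcover : ∀ i, ∃ k, v k i ≠ 0) :
    Fintype.card ι ≤ Module.finrank F (Submodule.span F (Set.range v)) * n := by
  classical
  obtain ⟨f, hf, hspan, -⟩ := Submodule.exists_fun_fin_finrank_span_eq F (Set.range v)
  have huniv : (Finset.univ : Finset ι) ⊆
      Finset.univ.biUnion fun a => Finset.univ.filter fun j => f a j ≠ 0 := by
    intro i _
    by_contra hi
    simp only [Finset.mem_biUnion, Finset.mem_filter, Finset.mem_univ, true_and, not_exists,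
      not_not] at hi
    have hle : Submodule.span F (Set.range f) ≤
        LinearMap.ker (LinearMap.proj i : (ι → F) →ₗ[F] F) := by
      rw [Submodule.span_le]
      rintro _ ⟨a, rfl⟩
      exact hi a
    obtain ⟨k, hk⟩ := hcover i
    have hmem : v k ∈ Submodule.span F (Set.range f) := by
      rw [hspan]
      exact Submodule.subset_span ⟨k, rfl⟩
    exact hk (hle hmem)
  calc Fintype.card ι ≤ _ := Finset.card_le_card huniv
    _ ≤ Finset.univ.card * n := Finset.card_biUnion_le_card_mul _ _ _ fun a _ => by
        obtain ⟨k, hk⟩ := hf a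
        exact hk ▸ hv k
    _ = _ := by rw [Finset.card_univ, Fintype.card_fin]

/-- Corollary 1: any scalar-linear solution to the single-message PIR-SI problem with `K`
messages and side-information size `M` downloads at least `⌈K/(M+1)⌉` symbols, i.e.
the scalar-linear capacity is at most `1/⌈K/(M+1)⌉`. -/
theorem smPirSi_download_lower_bound (F : Type*) [Field F] [Fintype F] {T K M : ℕ}
    (hK : 1 ≤ K) (E : Matrix (Fin T) (Fin K) F)
    (hE : ∀ i : Fin K, ∃ S : Finset (Fin K), i ∉ S ∧ S.card ≤ M ∧
      (Pi.single i 1 : Fin K → F) ∈ rowUnitSpan F E S) :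
    ⌈(K : ℚ) / (M + 1)⌉₊ ≤ T := by
  classical
  have hrow : ∀ i, ∃ y ∈ Submodule.span F (Set.range fun t => E t),
      y i ≠ 0 ∧ (Finset.univ.filter fun j => y j ≠ 0).card ≤ M + 1 := fun i => by
    obtain ⟨S, hi, hS, h⟩ := hE i
    obtain ⟨y, hy, hyi, hsupp⟩ := exists_mem_span_rows_of_single_mem_rowUnitSpan hi h
    refine ⟨y, hy, hyi, ?_⟩
    calc _ ≤ (insert i S).card :=
          Finset.card_le_card fun j hj => hsupp j (Finset.mem_filter.mp hj).2
      _ ≤ S.card + 1 := Finset.card_insert_le i S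
      _ ≤ M + 1 := by gcongr
  choose v hvE hvi hcard using hrow
  have hfin : Module.finrank F (Submodule.span F (Set.range v)) ≤ T :=
    calc _ ≤ Module.finrank F (Submodule.span F (Set.range fun t => E t)) :=
          Submodule.finrank_mono (Submodule.span_le.mpr (Set.range_subset_iff.mpr hvE))
      _ ≤ Fintype.card (Fin T) := finrank_range_le_card _
      _ = T := Fintype.card_fin T
  have hKT : K ≤ T * (M + 1) :=
    calc K = Fintype.card (Fin K) := (Fintype.card_fin K).symm
      _ ≤ _ := card_le_finrank_span_mul v hcard fun i => ⟨i, hvi i⟩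
      _ ≤ T * (M + 1) := by gcongr
  rw [Nat.ceil_le, div_le_iff₀ (by positivity)]
  exact_mod_cast hKT
end

section
/- Let F_q be a finite field, M ≥ 1, and K a multiple of M+1, and set T = K/(M+1). Let E be a T×K matrix over F_q that satisfies the single-message PIR-SI condition with side-information size M. Then there exist a partition of {1,…,K} into T blocks B_1,…,B_T, each of size exactly M+1, and a basis v_1,…,v_T of the row space of E such that for each t the support of v_t (the set of coordinates where v_t is nonzero) is exactly B_t. (In particular, every optimal scalar-linear SM-PIR-SI solution can be brought to the block-diagonal Partition-and-Code form by elementary row operations and column permutations.) -/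
open Finset in
/-- A cover of a type with `|ι| * m` elements by sets of size at most `m`, indexed by `ι`, is
a partition into sets of size exactly `m`. -/
theorem card_eq_and_disjoint_of_cover {ι α : Type*} [Fintype ι] [Fintype α] [DecidableEq α]
    {m : ℕ} (B : ι → Finset α) (hB : ∀ t, #(B t) ≤ m) (hcover : ∀ i, ∃ t, i ∈ B t)
    (hcard : Fintype.card α = Fintype.card ι * m) :
    (∀ t, #(B t) = m) ∧ ∀ s t, s ≠ t → Disjoint (B s) (B t) := by
  classical
  have hcount : ∑ i : α, #{t | i ∈ B t} = ∑ t, #(B t) := by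
    have h := sum_card_bipartiteAbove_eq_sum_card_bipartiteBelow
      (s := (univ : Finset α)) (t := (univ : Finset ι)) (fun i t => i ∈ B t)
    simpa [bipartiteAbove, bipartiteBelow] using h
  have hpos : ∀ i ∈ (univ : Finset α), 1 ≤ #{t | i ∈ B t} := fun i _ => by
    obtain ⟨t, ht⟩ := hcover i
    exact card_pos.2 ⟨t, by simpa using ht⟩
  have hle : ∑ t, #(B t) ≤ ∑ _t : ι, m := sum_le_sum fun t _ => hB t
  have hge : ∑ _i : α, 1 ≤ ∑ i : α, #{t | i ∈ B t} := sum_le_sum hpos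
  have hsum : ∑ _i : α, 1 = ∑ _t : ι, m := by simpa using hcard
  refine ⟨fun t => ?_, fun s t hst => ?_⟩
  · exact (sum_eq_sum_iff_of_le fun t _ => hB t).1 (by omega) t (mem_univ t)
  · rw [disjoint_left]
    intro i hs ht
    have h := (sum_eq_sum_iff_of_le hpos).1 (by omega) i (mem_univ i)
    exact hst (card_le_one.1 h.ge s (by simpa using hs) t (by simpa using ht))

/-- A unit vector `e_i` in the span of the rows and of unit vectors indexed by `S ∌ i` yields
a vector of the row space that is nonzero at `i` and supported on `S ∪ {i}`. -/
theorem exists_mem_rowSpan_of_single_mem {F : Type*} [Field F] {T K : ℕ}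
    (E : Matrix (Fin T) (Fin K) F) {S : Finset (Fin K)} {i : Fin K} (hi : i ∉ S)
    (h : (Pi.single i 1 : Fin K → F) ∈ rowUnitSpan F E S) :
    ∃ w ∈ Submodule.span F (Set.range fun t => E t),
      w i ≠ 0 ∧ ∀ j, w j ≠ 0 → j ∈ insert i S := by
  rw [rowUnitSpan, Submodule.span_union, Submodule.mem_sup] at h
  obtain ⟨y, hy, z, hz, hyz⟩ := h
  have hz0 : ∀ j ∉ S, z j = 0 := by
    intro j hj
    have hker : Submodule.span F
        ((fun j => Pi.single j (1 : F)) '' (S : Set (Fin K))) ≤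
        LinearMap.ker (LinearMap.proj j : (Fin K → F) →ₗ[F] F) := by
      rw [Submodule.span_le]
      rintro _ ⟨k, hk, rfl⟩
      have hjk : j ≠ k := fun e => hj (e ▸ hk)
      simp [hjk]
    simpa using hker hz
  have hy' : ∀ j ∉ S, y j = (Pi.single i 1 : Fin K → F) j := fun j hj => by
    rw [← hyz, Pi.add_apply, hz0 j hj, add_zero]
  refine ⟨y, hy, by simp [hy' i hi], fun j hj => ?_⟩
  by_contra hjS
  rw [Finset.mem_insert, not_or] at hjS
  exact hj (by simp [hy' j hjS.2, hjS.1])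

/-- Structure of optimal scalar-linear SM-PIR-SI solutions: if `(M+1) ∣ K` and
`T = K/(M+1)`, any solution `E` of the SM-PIR-SI problem admits a partition of the `K`
coordinates into `T` blocks of size `M+1` and a basis of its row space whose `t`-th vector
is supported exactly on the `t`-th block (the Partition-and-Code form). -/
theorem smPirSi_optimal_structure (F : Type*) [Field F] [Fintype F] {T K M : ℕ}
    (hM : 1 ≤ M) (hdvd : (M + 1) ∣ K) (hT : T = K / (M + 1))
    (E : Matrix (Fin T) (Fin K) F)
    (hE : ∀ i : Fin K, ∃ S : Finset (Fin K), i ∉ S ∧ S.card ≤ M ∧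
      (Pi.single i 1 : Fin K → F) ∈ rowUnitSpan F E S) :
    ∃ (B : Fin T → Finset (Fin K)) (v : Fin T → Fin K → F),
      (∀ t, (B t).card = M + 1) ∧
      (∀ s t, s ≠ t → Disjoint (B s) (B t)) ∧
      (Finset.univ.biUnion B = Finset.univ) ∧
      LinearIndependent F v ∧
      Submodule.span F (Set.range v) = Submodule.span F (Set.range (fun t => E t)) ∧
      (∀ t, {i | v t i ≠ 0} = ↑(B t)) := by
  classical
  choose S hiS hSM hS using hE
  choose w hwE hwi hwS using fun i => exists_mem_rowSpan_of_single_mem E (hiS i) (hS i)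
  obtain ⟨b, hbw, hbspan, hbli⟩ := exists_linearIndependent F (Set.range w)
  have hbfin : b.Finite := (Set.finite_range w).subset hbw
  have : Fintype b := hbfin.fintype
  have hK : K = T * (M + 1) := by rw [hT, Nat.div_mul_cancel hdvd]
  have hbE : Submodule.span F b ≤ Submodule.span F (Set.range fun t => E t) := by
    rw [hbspan, Submodule.span_le]
    rintro _ ⟨i, rfl⟩
    exact hwE i
  have hET : Module.finrank F (Submodule.span F (Set.range fun t => E t)) ≤ T := by
    simpa [Set.finrank] using finrank_range_le_card (R := F) (fun t => E t)
  have hbrank : Module.finrank F (Submodule.span F b) = Fintype.card b := by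
    rw [finrank_span_set_eq_card hbli, Set.toFinset_card]
  have hsupp : ∀ x : b, (Finset.univ.filter fun i => (x : Fin K → F) i ≠ 0).card ≤ M + 1 := by
    rintro ⟨x, hx⟩
    obtain ⟨i, rfl⟩ := hbw hx
    calc _ ≤ (insert i (S i)).card :=
          Finset.card_le_card fun j hj => hwS i j (by simpa using hj)
      _ ≤ M + 1 := (Finset.card_insert_le _ _).trans (by have := hSM i; omega)
  have hcover : ∀ i, ∃ x : b, (x : Fin K → F) i ≠ 0 := by
    intro i
    by_contra! h
    have hker : Submodule.span F b ≤
        LinearMap.ker (LinearMap.proj i : (Fin K → F) →ₗ[F] F) := by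
      rw [Submodule.span_le]
      exact fun x hx => by simpa using h ⟨x, hx⟩
    have hw : w i ∈ Submodule.span F b := hbspan ▸ Submodule.subset_span ⟨i, rfl⟩
    exact hwi i (by simpa using hker hw)
  have hbT : Fintype.card b = T := by
    refine le_antisymm ?_ ?_
    · exact hbrank ▸ (Submodule.finrank_mono hbE).trans hET
    · have hle : K ≤ Fintype.card b * (M + 1) := by
        calc K = (Finset.univ : Finset (Fin K)).card := by simp
          _ ≤ (Finset.univ.biUnion fun x : b =>
                Finset.univ.filter fun i => (x : Fin K → F) i ≠ 0).card :=
              Finset.card_le_card fun i _ => by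
                obtain ⟨x, hx⟩ := hcover i
                exact Finset.mem_biUnion.2 ⟨x, Finset.mem_univ x, by simpa using hx⟩
          _ ≤ _ := Finset.card_biUnion_le_card_mul _ _ _ fun x _ => hsupp x
      exact Nat.le_of_mul_le_mul_right (hK ▸ hle) M.succ_pos
  let e : Fin T ≃ b := (Fintype.equivFinOfCardEq hbT).symm
  have hcoverB : ∀ i, ∃ t, i ∈ Finset.univ.filter fun i => (e t : Fin K → F) i ≠ 0 := fun i => by
    obtain ⟨x, hx⟩ := hcover i
    exact ⟨e.symm x, by simpa using hx⟩
  obtain ⟨hcard, hdisj⟩ := card_eq_and_disjoint_of_cover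
    (fun t => Finset.univ.filter fun i => (e t : Fin K → F) i ≠ 0) (fun t => hsupp (e t))
    hcoverB (by simpa using hK)
  refine ⟨_, fun t => (e t : Fin K → F), hcard, hdisj, ?_, hbli.comp e e.injective, ?_, ?_⟩
  · ext i
    simpa using hcoverB i
  · have hrange : Set.range (fun t => (e t : Fin K → F)) = b := by
      rw [← Function.comp_def, e.surjective.range_comp, Subtype.range_coe]
    rw [hrange]
    exact Submodule.eq_of_le_of_finrank_le hbE (by rw [hbrank, hbT]; exact hET)
  · intro t
    simp
end

section
/- Let F_q be a finite field, and let E be a T×K matrix over F_q that satisfies the D-message PIR-SI condition with side-information size M (i.e., for every set W ⊆ {1,…,K} with |W| = D there exists a set S ⊆ {1,…,K}\W with |S| ≤ M such that for every i ∈ W, e_i lies in the span of the rows of E together with the unit vectors e_j, j ∈ S). Then the dual code C = {x ∈ F_q^K : Ex = 0} has (M,D)-cooperative locality: for every Δ ⊆ {1,…,K} with |Δ| = D there exists Γ ⊆ {1,…,K}\Δ with |Γ| ≤ M such that any two elements of C that agree on every coordinate in Γ also agree on every coordinate in Δ. -/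
/-- Every vector in the span of the rows of `E` and the unit vectors indexed by `S` has the same
dot product with any two elements of the kernel of `E` that agree on `S`. -/
theorem dotProduct_eq_of_mem_rowUnitSpan {F : Type*} [Field F] {T K : ℕ}
    {E : Matrix (Fin T) (Fin K) F} {S : Finset (Fin K)} {v x y : Fin K → F}
    (hv : v ∈ rowUnitSpan F E S) (hx : E.mulVec x = 0) (hy : E.mulVec y = 0)
    (hxy : ∀ j ∈ S, x j = y j) : v ⬝ᵥ x = v ⬝ᵥ y := by
  unfold rowUnitSpan at hv
  induction hv using Submodule.span_induction with
  | mem v hv =>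
    obtain ⟨t, rfl⟩ | ⟨j, hj, rfl⟩ := hv
    · exact (congrFun hx t).trans (congrFun hy t).symm
    · simpa using hxy j hj
  | zero => simp
  | add u v _ _ hu hv => rw [add_dotProduct, add_dotProduct, hu, hv]
  | smul a v _ hv => rw [smul_dotProduct, smul_dotProduct, hv]

/-- Theorem 3: any scalar-linear solution `E` to the `D`-message PIR-SI problem with
side-information size `M` is a parity check matrix of a code with block-length `K` and
`(M,D)`-cooperative locality. -/
theorem mmPirSi_dual_is_cooperativeLRC (F : Type*) [Field F] [Fintype F] {T K M D : ℕ}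
    (E : Matrix (Fin T) (Fin K) F)
    (hE : ∀ W : Finset (Fin K), W.card = D → ∃ S : Finset (Fin K),
      Disjoint S W ∧ S.card ≤ M ∧
      ∀ i ∈ W, (Pi.single i 1 : Fin K → F) ∈ rowUnitSpan F E S) :
    ∀ Δ : Finset (Fin K), Δ.card = D → ∃ Γ : Finset (Fin K),
      Disjoint Γ Δ ∧ Γ.card ≤ M ∧
      ∀ x y : Fin K → F, E.mulVec x = 0 → E.mulVec y = 0 →
        (∀ j ∈ Γ, x j = y j) → ∀ i ∈ Δ, x i = y i := by
  intro Δ hΔ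
  obtain ⟨S, hdisj, hcard, hspan⟩ := hE Δ hΔ
  refine ⟨S, hdisj, hcard, fun x y hx hy hxy i hi => ?_⟩
  simpa using dotProduct_eq_of_mem_rowUnitSpan (hspan i hi) hx hy hxy
end

section
/- Let F_q be a finite field and let C ⊆ F_q^n be a linear code (subspace) of dimension k that has (r,ℓ)-cooperative locality, where r < ℓ ≤ n. Then k ≤ r. (Equivalently, for ℓ > r, the rate of a linear (n,k,r,ℓ) cooperative LRC is at most r/n.) -/
/-- The shortening of a code `C` at `S`: the codewords of `C` vanishing on `S`. -/
def shortenedCode {F ι : Type*} [Field F] (C : Submodule F (ι → F)) (S : Finset ι) :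
    Submodule F (ι → F) :=
  C ⊓ Submodule.pi (S : Set ι) fun _ => ⊥

theorem mem_shortenedCode {F ι : Type*} [Field F] {C : Submodule F (ι → F)} {S : Finset ι}
    {x : ι → F} : x ∈ shortenedCode C S ↔ x ∈ C ∧ ∀ i ∈ S, x i = 0 := by
  simp [shortenedCode, Submodule.mem_pi]

/-- Shortening at `S` lowers the dimension by at most `S.card`. -/
theorem finrank_le_finrank_shortenedCode_add_card {F ι : Type*} [Field F] [Finite ι]
    (C : Submodule F (ι → F)) (S : Finset ι) :
    Module.finrank F C ≤ Module.finrank F (shortenedCode C S) + S.card := by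
  let f : C →ₗ[F] (S → F) := LinearMap.funLeft F F Subtype.val ∘ₗ C.subtype
  have hker : (LinearMap.ker f).map C.subtype ≤ shortenedCode C S := by
    rintro _ ⟨x, hx, rfl⟩
    exact mem_shortenedCode.2 ⟨x.2, fun i hi => congrFun (LinearMap.mem_ker.1 hx) ⟨i, hi⟩⟩
  have hker_le := Submodule.finrank_mono hker
  rw [Submodule.finrank_map_subtype_eq] at hker_le
  have hrange := Submodule.finrank_le (LinearMap.range f)
  rw [Module.finrank_fintype_fun_eq_card, Fintype.card_coe] at hrange
  have := f.finrank_range_add_finrank_ker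
  lia

/-- A code of dimension at least `m` has `m` linearly independent coordinates: shortening there
lowers the dimension by at least `m`. -/
theorem exists_card_eq_finrank_shortenedCode_add_le {F ι : Type*} [Field F] [Finite ι]
    (C : Submodule F (ι → F)) {m : ℕ} (hm : m ≤ Module.finrank F C) :
    ∃ S : Finset ι, S.card = m ∧
      Module.finrank F (shortenedCode C S) + m ≤ Module.finrank F C := by
  classical
  induction m with
  | zero => exact ⟨∅, rfl, Submodule.finrank_mono inf_le_left⟩
  | succ m ih =>
    obtain ⟨S, hS, hle⟩ := ih (by lia)
    have hpos := finrank_le_finrank_shortenedCode_add_card C S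
    have hne : shortenedCode C S ≠ ⊥ := by
      intro h
      rw [h, finrank_bot] at hpos
      lia
    obtain ⟨x, hx, hx0⟩ := Submodule.exists_mem_ne_zero_of_ne_bot hne
    obtain ⟨i, hi⟩ := Function.ne_iff.1 hx0
    have hiS : i ∉ S := fun h => hi ((mem_shortenedCode.1 hx).2 i h)
    have hlt : shortenedCode C (insert i S) < shortenedCode C S := by
      refine lt_of_le_of_ne (fun y hy => ?_) fun h => ?_
      · obtain ⟨hyC, hy⟩ := mem_shortenedCode.1 hy
        exact mem_shortenedCode.2 ⟨hyC, fun j hj => hy j (Finset.mem_insert_of_mem hj)⟩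
      · rw [← h] at hx
        exact hi ((mem_shortenedCode.1 hx).2 i (Finset.mem_insert_self i S))
    have := Submodule.finrank_lt_finrank_of_lt hlt
    exact ⟨insert i S, by rw [Finset.card_insert_of_notMem hiS, hS], by lia⟩

/-- Corollary 4: a linear `(n,k,r,ℓ)` cooperative LRC with `ℓ > r` has `k ≤ r`
(equivalently, its rate is at most `r/n`). -/
theorem cooperativeLRC_rate_bound (F : Type*) [Field F] {n k r ℓ : ℕ}
    (C : Submodule F (Fin n → F)) (hk : Module.finrank F C = k)
    (hrl : r < ℓ) (hln : ℓ ≤ n)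
    (hloc : ∀ Δ : Finset (Fin n), Δ.card = ℓ → ∃ Γ : Finset (Fin n),
      Disjoint Γ Δ ∧ Γ.card ≤ r ∧
      ∀ x ∈ C, ∀ y ∈ C, (∀ j ∈ Γ, x j = y j) → ∀ i ∈ Δ, x i = y i) :
    k ≤ r := by
  by_contra! hrk
  obtain ⟨S, hS, hSle⟩ :=
    exists_card_eq_finrank_shortenedCode_add_le C (m := r + 1) (by lia)
  obtain ⟨Δ, hSΔ, hΔ⟩ := Finset.exists_superset_card_eq (s := S) (n := ℓ) (by lia) (by simpa)
  obtain ⟨Γ, -, hΓ, hrec⟩ := hloc Δ hΔ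
  have hle : shortenedCode C Γ ≤ shortenedCode C S := fun x hx => by
    obtain ⟨hxC, hx⟩ := mem_shortenedCode.1 hx
    exact mem_shortenedCode.2 ⟨hxC, fun i hi => hrec x hxC 0 C.zero_mem hx i (hSΔ hi)⟩
  have := Submodule.finrank_mono hle
  have := finrank_le_finrank_shortenedCode_add_card C Γ
  lia
end

section
/- Let F_q be a finite field, 0 ≤ M < K, and let E be a T×K matrix over F_q that satisfies the (W,S)-PIR-SI condition with side-information size M (i.e., for every set S ⊆ {1,…,K} with |S| = M and every i ∈ {1,…,K}\S, e_i lies in the span of the rows of E together with the unit vectors e_j, j ∈ S). Then every set of K−M columns of E is linearly independent; that is, E is a parity check matrix of a (K, M) MDS code. -/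
/-- Theorem 5: any scalar-linear solution `E` to the `(W,S)`-PIR-SI problem with
side-information size `M < K` must be a parity check matrix of a `(K,M)` MDS code:
every set of `K - M` columns of `E` is linearly independent. -/
theorem wsPirSi_is_MDS (F : Type*) [Field F] [Fintype F] {T K M : ℕ}
    (hMK : M < K)
    (E : Matrix (Fin T) (Fin K) F)
    (hE : ∀ S : Finset (Fin K), S.card = M → ∀ i : Fin K, i ∉ S →
      (Pi.single i 1 : Fin K → F) ∈ rowUnitSpan F E S) :
    ∀ cols : Finset (Fin K), cols.card = K - M →
      LinearIndependent F (fun j : cols => (E.transpose (j : Fin K) : Fin T → F)) := by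
  intro cols hcols
  rw [Fintype.linearIndependent_iff]
  intro g hg i
  set v : Fin K → F := fun k => if h : k ∈ cols then g ⟨k, h⟩ else 0 with hv
  have hrow (t : Fin T) : E t ⬝ᵥ v = 0 := by
    have hsum : ∑ k ∈ cols, E t k * v k = E t ⬝ᵥ v :=
      Finset.sum_subset (Finset.subset_univ cols) fun k _ hk => by simp [hv, hk]
    rw [← hsum, ← Finset.sum_coe_sort]
    simpa [hv, mul_comm, Finset.sum_apply] using congrFun hg t
  have hle : rowUnitSpan F E colsᶜ ≤ LinearMap.ker (dotProductBilin F F |>.flip v) := by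
    refine Submodule.span_le.2 ?_
    rintro _ (⟨t, rfl⟩ | ⟨j, hj, rfl⟩)
    · exact hrow t
    · have hj' : j ∉ cols := by simpa using hj
      simp [hv, hj']
  have hcard : colsᶜ.card = M := by
    rw [Finset.card_compl, Fintype.card_fin, hcols]
    omega
  have hi := hle (hE colsᶜ hcard i (by simp))
  simpa [hv] using hi
end

section
/- Let F_q be a finite field, let C ⊆ F_q^K be a linear subspace, and let Δ, Γ ⊆ {1,…,K} be disjoint sets such that any two elements of C that agree on every coordinate in Γ also agree on every coordinate in Δ. Then for every i ∈ Δ, the unit vector e_i lies in the subspace C^⊥ + span{e_j : j ∈ Γ}, where C^⊥ = {v ∈ F_q^K : Σ_{l=1}^K v_l c_l = 0 for all c ∈ C} is the dual code of C. (This is the key step showing that a parity check matrix of a code with (cooperative) locality yields a PIR-SI solution, as in Theorems 2 and 4.) -/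
/-- The dual code of a linear code `C ⊆ F^K`:
all vectors `v` with `∑ l, v l * c l = 0` for every codeword `c ∈ C`. -/
def dualCode (F : Type*) [Field F] (K : ℕ) (C : Submodule F (Fin K → F)) :
    Submodule F (Fin K → F) where
  carrier := {v | ∀ c ∈ C, ∑ l, v l * c l = 0}
  add_mem' := by
    intro a b ha hb c hc
    simp only [Pi.add_apply, add_mul, Finset.sum_add_distrib, Set.mem_setOf_eq] at *
    rw [ha c hc, hb c hc, add_zero]
  zero_mem' := by
    intro c hc
    simp
  smul_mem' := by
    intro r v hv c hc
    simp only [Pi.smul_apply, smul_eq_mul, mul_assoc, ← Finset.mul_sum,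
      Set.mem_setOf_eq] at *
    rw [hv c hc, mul_zero]

/-- Key step for Theorems 2 and 4: if the coordinates in `Δ` of every codeword of `C` are
determined by the coordinates in `Γ` (with `Δ` and `Γ` disjoint), then for every `i ∈ Δ`
the unit vector `e_i` lies in `C^⊥ + span{e_j : j ∈ Γ}`. -/
theorem locality_gives_dual_vector (F : Type*) [Field F] {K : ℕ}
    (C : Submodule F (Fin K → F)) (Δ Γ : Finset (Fin K))
    (hdisj : Disjoint Δ Γ)
    (hrec : ∀ x ∈ C, ∀ y ∈ C, (∀ j ∈ Γ, x j = y j) → ∀ i ∈ Δ, x i = y i) :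
    ∀ i ∈ Δ, (Pi.single i 1 : Fin K → F) ∈
      dualCode F K C ⊔
        Submodule.span F ((fun j => Pi.single j (1 : F)) '' (Γ : Set (Fin K))) := by
  intro i hi
  let L : Γ → C →ₗ[F] F := fun j => LinearMap.proj j.1 ∘ₗ C.subtype
  let M : C →ₗ[F] F := LinearMap.proj i ∘ₗ C.subtype
  have hker : ⨅ j, LinearMap.ker (L j) ≤ LinearMap.ker M := by
    intro c hc
    rw [Submodule.mem_iInf] at hc
    exact hrec c c.2 0 C.zero_mem (fun j hj => hc ⟨j, hj⟩) i hi
  obtain ⟨a, ha⟩ :=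
    (Submodule.mem_span_range_iff_exists_fun F).1 (mem_span_of_iInf_ker_le_ker hker)
  rw [Submodule.mem_sup]
  refine ⟨Pi.single i 1 - ∑ j, a j • Pi.single j.1 1, ?_, ∑ j, a j • Pi.single j.1 1, ?_,
    sub_add_cancel _ _⟩
  · intro c hc
    have h : ∑ j, a j * c j.1 = c i := by
      simpa [L, M] using LinearMap.congr_fun ha ⟨c, hc⟩
    change (Pi.single i 1 - ∑ j, a j • Pi.single j.1 1) ⬝ᵥ c = 0
    simp only [sub_dotProduct, sum_dotProduct, smul_dotProduct, single_one_dotProduct,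
      smul_eq_mul, h, sub_self]
  · exact Submodule.sum_mem _ fun j _ =>
      Submodule.smul_mem _ _ (Submodule.subset_span ⟨j.1, j.2, rfl⟩)
end

section
/- Let F_q be a finite field with q elements and let C ⊆ F_q^n be a (possibly non-linear) code with locality r ≥ 1, i.e., for every coordinate i ∈ {1,…,n} there exist a set R(i) ⊆ {1,…,n}\{i} with |R(i)| ≤ r and a function g_i : F_q^{R(i)} → F_q such that c_i = g_i(c|_{R(i)}) for every c ∈ C. Then |C| ≤ q^{n − ⌈n/(r+1)⌉}. -/
/-- A (possibly non-linear) code `C ⊆ F^n` has locality `r`: every coordinate `i` can be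
computed, by a fixed function `g`, from the values of at most `r` other coordinates. -/
def HasLocality {F : Type*} {n : ℕ} (C : Set (Fin n → F)) (r : ℕ) : Prop :=
  ∀ i : Fin n, ∃ R : Finset (Fin n), i ∉ R ∧ R.card ≤ r ∧
    ∃ g : ({x : Fin n // x ∈ R} → F) → F, ∀ c ∈ C, g (fun l => c l.val) = c i

/-- In a finite directed graph whose vertices have at most `r` out-neighbours, at least one
vertex in `(r + 1)` can be kept so that the remaining induced subgraph is acyclic. -/
theorem exists_acyclic_subset {α : Type*} [DecidableEq α] (R : α → Finset α) (r : ℕ)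
    (hself : ∀ i, i ∉ R i) (hcard : ∀ i, (R i).card ≤ r) (S : Finset α) :
    ∃ U ⊆ S, S.card ≤ (r + 1) * U.card ∧
      ∀ T ⊆ U, T.Nonempty → ∃ i ∈ T, Disjoint (R i) T := by
  induction S using Finset.strongInduction with
  | H S ih =>
    rcases S.eq_empty_or_nonempty with rfl | hS
    · refine ⟨∅, subset_rfl, by simp, fun T hT hne => ?_⟩
      exact absurd (Finset.subset_empty.mp hT) hne.ne_empty
    obtain ⟨v, hvS, hv⟩ : ∃ v ∈ S, (S.filter fun u => v ∈ R u).card ≤ r := by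
      refine Finset.exists_le_of_sum_le hS ?_
      have hcount := Finset.sum_card_bipartiteAbove_eq_sum_card_bipartiteBelow
        (s := S) (t := S) (fun v u => v ∈ R u)
      simp only [Finset.bipartiteAbove, Finset.bipartiteBelow] at hcount
      rw [hcount]
      refine Finset.sum_le_sum fun u _ => le_trans (Finset.card_le_card fun w hw => ?_) (hcard u)
      exact (Finset.mem_filter.mp hw).2
    set B := insert v (S.filter fun u => v ∈ R u) with hB
    have hBcard : B.card ≤ r + 1 := (Finset.card_insert_le _ _).trans (by omega)
    have hvB : v ∈ B := Finset.mem_insert_self _ _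
    obtain ⟨U, hUS, hUcard, hU⟩ := ih (S \ B) <| by
      refine Finset.ssubset_iff_subset_ne.mpr ⟨Finset.sdiff_subset, fun h => ?_⟩
      rw [← h] at hvS
      exact (Finset.mem_sdiff.mp hvS).2 hvB
    have hvU : v ∉ U := fun h => (Finset.mem_sdiff.mp (hUS h)).2 hvB
    refine ⟨insert v U, ?_, ?_, fun T hT hne => ?_⟩
    · exact Finset.insert_subset hvS (hUS.trans Finset.sdiff_subset)
    · rw [Finset.card_insert_of_notMem hvU]
      have := Finset.le_card_sdiff B S
      rw [mul_add, mul_one]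
      omega
    · rcases (T.erase v).eq_empty_or_nonempty with h | h
      · have hTv : T = {v} := by
          rcases Finset.erase_eq_empty_iff T v |>.mp h with h | h
          · exact absurd h hne.ne_empty
          · exact h
        exact ⟨v, by simp [hTv], by simp [hTv, hself]⟩
      · obtain ⟨i, hi, hdisj⟩ := hU (T.erase v) (Finset.subset_insert_iff.mp hT) h
        have hiU : i ∈ U := Finset.subset_insert_iff.mp hT hi
        have hiS := Finset.mem_sdiff.mp (hUS hiU)
        have hvi : v ∉ R i := fun hvi =>
          hiS.2 (Finset.mem_insert_of_mem (Finset.mem_filter.mpr ⟨hiS.1, hvi⟩))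
        refine ⟨i, Finset.mem_of_mem_erase hi, Finset.disjoint_left.mpr fun j hj hjT => ?_⟩
        refine Finset.disjoint_left.mp hdisj hj (Finset.mem_erase.mpr ⟨?_, hjT⟩)
        rintro rfl
        exact hvi hj

/-- Proposition 3 (Tamo–Barg): any (possibly non-linear) code `C ⊆ F_q^n` with locality
`r ≥ 1` has size at most `q^(n - ⌈n/(r+1)⌉)`. -/
theorem LRC_max_size {F : Type*} [Field F] [Fintype F] {n r : ℕ} (hr : 1 ≤ r)
    (C : Set (Fin n → F)) (hC : HasLocality C r) :
    Nat.card C ≤ Fintype.card F ^ (n - ⌈(n : ℚ) / (r + 1)⌉₊) := by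
  classical
  choose R hself hcard g hg using hC
  obtain ⟨U, -, hUcard, hU⟩ := exists_acyclic_subset R r hself hcard Finset.univ
  rw [Finset.card_univ, Fintype.card_fin] at hUcard
  have hinj : Function.Injective
      (fun (c : C) (i : {i : Fin n // i ∈ Uᶜ}) => c.1 i.1) := by
    rintro ⟨c, hc⟩ ⟨d, hd⟩ hcd
    have hagree : ∀ i ∉ U, c i = d i := fun i hi =>
      congrFun hcd ⟨i, Finset.mem_compl.mpr hi⟩
    by_contra hne
    have hT : (Finset.univ.filter fun i => c i ≠ d i).Nonempty := by
      obtain ⟨i, hi⟩ := Function.ne_iff.mp fun h : c = d => hne (Subtype.ext h)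
      exact ⟨i, by simpa using hi⟩
    obtain ⟨i, hi, hdisj⟩ := hU _ (fun i hi => by
      by_contra hiU
      exact (Finset.mem_filter.mp hi).2 (hagree i hiU)) hT
    refine (Finset.mem_filter.mp hi).2 ?_
    rw [← hg i c hc, ← hg i d hd]
    congr 1
    funext l
    by_contra hl
    exact Finset.disjoint_left.mp hdisj l.2 (by simpa using hl)
  have hceil : ⌈(n : ℚ) / (r + 1)⌉₊ ≤ U.card := by
    rw [Nat.ceil_le, div_le_iff₀ (by positivity), mul_comm]
    exact_mod_cast hUcard
  calc Nat.card C ≤ Nat.card ({i : Fin n // i ∈ Uᶜ} → F) :=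
        Nat.card_le_card_of_injective _ hinj
    _ = Fintype.card F ^ (n - U.card) := by
        rw [Nat.card_eq_fintype_card, Fintype.card_fun, Fintype.card_coe, Finset.card_compl,
          Fintype.card_fin]
    _ ≤ Fintype.card F ^ (n - ⌈(n : ℚ) / (r + 1)⌉₊) :=
        Nat.pow_le_pow_right Fintype.card_pos (by omega)
end

section
/- Let F_q be a finite field with q elements, K ≥ 1, M ≥ 1, and set T* = ⌈K/(M+1)⌉. Let C ⊆ F_q^K be a (possibly non-linear) code with locality M and with |C| = q^{K−T*} (an optimal LRC). Then there exists a partition of {1,…,K} into two sets P_1 and P_2 with |P_1| = K − T* and |P_2| = T* such that any two codewords of C that agree on every coordinate in P_1 also agree on every coordinate in P_2 (i.e., the symbols on P_2 are a function of the symbols on P_1). -/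
open Finset in
/-- If every vertex of a digraph has at most `M` out-neighbours, then every nonempty finite set of
vertices has a member with at most `M` in-neighbours inside the set. -/
theorem exists_card_filter_mem_le {α : Type*} [DecidableEq α] {M : ℕ} (R : α → Finset α)
    (hR : ∀ i, (R i).card ≤ M) {A : Finset α} (hA : A.Nonempty) :
    ∃ v ∈ A, (A.filter fun i => v ∈ R i).card ≤ M := by
  refine exists_le_of_sum_le (f := fun v => (A.filter fun i => v ∈ R i).card)
    (g := fun _ => M) hA ?_
  calc ∑ v ∈ A, (A.filter fun i => v ∈ R i).card
      = ∑ i ∈ A, (A.filter fun v => v ∈ R i).card :=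
        sum_card_bipartiteAbove_eq_sum_card_bipartiteBelow (fun v i => v ∈ R i)
    _ ≤ ∑ _i ∈ A, M := sum_le_sum fun i _ =>
        (card_le_card fun _ hv => (mem_filter.1 hv).2).trans (hR i)

open Finset in
/-- A loopless digraph with out-degrees at most `M` contains, inside any finite set `A`, a set `S`
of at least `A.card / (M + 1)` vertices that induces an acyclic subgraph, in the sense that any
property which holds off `S` and passes from the out-neighbours of a vertex of `S` to that vertex
holds everywhere. -/
theorem exists_large_acyclic_subset {α : Type*} [DecidableEq α] {M : ℕ} (R : α → Finset α)
    (hR : ∀ i, (R i).card ≤ M) (hirr : ∀ i, i ∉ R i) (A : Finset α) :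
    ∃ S ⊆ A, A.card ≤ S.card * (M + 1) ∧
      ∀ P : α → Prop, (∀ i ∈ S, (∀ j ∈ R i, P j) → P i) → (∀ j, j ∉ S → P j) → ∀ j, P j := by
  induction A using Finset.strongInduction with
  | H A ih =>
    rcases A.eq_empty_or_nonempty with rfl | hA
    · exact ⟨∅, by simp, by simp, fun P _ h j => h j (by simp)⟩
    obtain ⟨v, hv, hcard⟩ := exists_card_filter_mem_le R hR hA
    set B := insert v (A.filter fun i => v ∈ R i) with hB
    have hBA : B ⊆ A := insert_subset hv (filter_subset _ _)
    have hBcard : B.card ≤ M + 1 := (card_insert_le _ _).trans (by omega)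
    have hvB : v ∈ B := mem_insert_self _ _
    obtain ⟨S, hSA, hScard, hS⟩ := ih (A \ B) (sdiff_ssubset hBA ⟨v, hvB⟩)
    have hvS : v ∉ S := fun h => (mem_sdiff.1 (hSA h)).2 hvB
    refine ⟨insert v S, insert_subset hv (hSA.trans sdiff_subset), ?_, fun P hP hout => ?_⟩
    · rw [card_insert_of_notMem hvS, add_mul, one_mul]
      have := card_sdiff_add_card_eq_card hBA
      omega
    · have hne : ∀ j, P j ∨ j = v := by
        refine hS _ (fun i hi h => Or.inl (hP i (mem_insert_of_mem hi) fun j hj => ?_)) ?_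
        · refine (h j hj).resolve_right ?_
          rintro rfl
          obtain ⟨hiA, hiB⟩ := mem_sdiff.1 (hSA hi)
          exact hiB (mem_insert_of_mem (mem_filter.2 ⟨hiA, hj⟩))
        · intro j hj
          by_cases hjv : j = v
          · exact Or.inr hjv
          · exact Or.inl (hout j (by simp [hjv, hj]))
      have hPv : P v := hP v (mem_insert_self _ _) fun j hj =>
        (hne j).resolve_right (by rintro rfl; exact hirr _ hj)
      intro j
      rcases hne j with h | rfl
      · exact h
      · exact hPv

/-- Lemma 2: for an optimal LRC `C ⊆ F_q^K` with locality `M` (of maximum possible size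
`q^(K - T*)`, with `T* = ⌈K/(M+1)⌉`), there is a partition of the `K` coordinates into
`P₁` (of size `K - T*`) and `P₂` (of size `T*`) such that the symbols on `P₂` are a
function of the symbols on `P₁`. -/
theorem optimalLRC_determined_coordinates {F : Type*} [Field F] [Fintype F] {K M : ℕ}
    (hK : 1 ≤ K) (hM : 1 ≤ M)
    (C : Set (Fin K → F)) (hloc : HasLocality C M)
    (hcard : Nat.card C = Fintype.card F ^ (K - ⌈(K : ℚ) / (M + 1)⌉₊)) :
    ∃ P₁ P₂ : Finset (Fin K),
      Disjoint P₁ P₂ ∧ P₁ ∪ P₂ = Finset.univ ∧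
      P₁.card = K - ⌈(K : ℚ) / (M + 1)⌉₊ ∧ P₂.card = ⌈(K : ℚ) / (M + 1)⌉₊ ∧
      ∀ c ∈ C, ∀ c' ∈ C, (∀ i ∈ P₁, c i = c' i) → ∀ i ∈ P₂, c i = c' i := by
  choose R hirr hR g hg using hloc
  obtain ⟨S, -, hScard, hS⟩ := exists_large_acyclic_subset R hR hirr Finset.univ
  have hT : ⌈(K : ℚ) / (M + 1)⌉₊ ≤ S.card := by
    rw [Nat.ceil_le, div_le_iff₀ (by positivity)]
    rw [Finset.card_univ, Fintype.card_fin] at hScard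
    exact_mod_cast hScard
  obtain ⟨P₂, hP₂S, hP₂⟩ := Finset.exists_subset_card_eq hT
  refine ⟨P₂ᶜ, P₂, disjoint_compl_left, compl_sup_eq_top, ?_, hP₂, ?_⟩
  · rw [Finset.card_compl, Fintype.card_fin, hP₂]
  · intro c hc c' hc' h i _
    refine hS (fun j => c j = c' j) (fun i _ hi => ?_) (fun j hj => ?_) i
    · rw [← hg i c hc, ← hg i c' hc']
      exact congrArg (g i) (funext fun l => hi l.val l.property)
    · exact h j (Finset.mem_compl.2 fun hj' => hj (hP₂S hj'))
end

section
/- Let F_q be a finite field with q elements, K ≥ 1, M ≥ 1, and set T* = ⌈K/(M+1)⌉. Let C ⊆ F_q^K be a (possibly non-linear) code with locality M and with |C| = q^{K−T*} (an optimal LRC). Then there exist q^{T*} distinct vectors u_0, u_1, …, u_{q^{T*}−1} ∈ F_q^K such that the translates C + u_j = {c + u_j : c ∈ C}, for j = 0,…,q^{T*}−1, are pairwise disjoint and their union is all of F_q^K. -/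
/-- A greedy choice of redundant coordinates: as long as `t - 1` recovery sets cannot cover all
coordinates, there are `t` coordinates `S` inside a set `D` such that codewords agreeing on
`D \ S` agree on `D`. -/
lemma HasLocality.exists_redundant_coords {F : Type*} {n r : ℕ} {C : Set (Fin n → F)}
    (hloc : HasLocality C r) (t : ℕ) (ht : ∀ s < t, s * (r + 1) < n) :
    ∃ S D : Finset (Fin n), S.card = t ∧ S ⊆ D ∧ D.card ≤ t * (r + 1) ∧
      ∀ c ∈ C, ∀ c' ∈ C, (∀ x ∈ D, x ∉ S → c x = c' x) → ∀ x ∈ D, c x = c' x := by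
  induction t with
  | zero => exact ⟨∅, ∅, by simp⟩
  | succ t ih =>
    obtain ⟨S, D, hS, hSD, hD, hrec⟩ := ih fun s hs => ht s (by omega)
    obtain ⟨i, hi⟩ : ∃ i, i ∉ D := by
      by_contra! h
      have hcard : D.card = n := by
        rw [Finset.eq_univ_iff_forall.2 h, Finset.card_univ, Fintype.card_fin]
      have := ht t (by omega)
      omega
    obtain ⟨R, hiR, hR, g, hg⟩ := hloc i
    refine ⟨insert i S, D ∪ insert i R, ?_, ?_, ?_, ?_⟩
    · rw [Finset.card_insert_of_notMem fun h => hi (hSD h), hS]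
    · intro x hx
      have := @hSD x
      simp only [Finset.mem_insert, Finset.mem_union] at hx ⊢
      tauto
    · have h₁ := Finset.card_union_le D (insert i R)
      have h₂ := Finset.card_insert_le i R
      rw [add_mul]
      omega
    · intro c hc c' hc' h
      have hagree : ∀ x ∈ D, c x = c' x := hrec c hc c' hc' fun x hxD hxS =>
        h x (Finset.mem_union_left _ hxD) fun hx => by
          rcases Finset.mem_insert.1 hx with rfl | hx
          exacts [hi hxD, hxS hx]
      have hagreeR : ∀ x ∈ R, c x = c' x := fun x hx => by
        by_cases hxD : x ∈ D
        · exact hagree x hxD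
        · refine h x (by simp [hx]) fun hx' => ?_
          rcases Finset.mem_insert.1 hx' with rfl | hx'
          exacts [hiR hx, hxD (hSD hx')]
      intro x hx
      rcases Finset.mem_union.1 hx with hx | hx
      · exact hagree x hx
      · rcases Finset.mem_insert.1 hx with rfl | hx
        · rw [← hg c hc, ← hg c' hc']
          congr 1
          funext l
          exact hagreeR l l.2
        · exact hagreeR x hx

/-- Lemma 3: for an optimal LRC `C ⊆ F_q^K` with locality `M` (of maximum possible size
`q^(K - T*)`, with `T* = ⌈K/(M+1)⌉`), there exist `q^(T*)` distinct vectors whose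
translates of `C` are pairwise disjoint and partition the whole space `F_q^K`. -/
theorem optimalLRC_translations_partition {F : Type*} [Field F] [Fintype F] {K M : ℕ}
    (hK : 1 ≤ K) (hM : 1 ≤ M)
    (C : Set (Fin K → F)) (hloc : HasLocality C M)
    (hcard : Nat.card C = Fintype.card F ^ (K - ⌈(K : ℚ) / (M + 1)⌉₊)) :
    ∃ u : Fin (Fintype.card F ^ ⌈(K : ℚ) / (M + 1)⌉₊) → (Fin K → F),
      Function.Injective u ∧
      (∀ i j, i ≠ j → Disjoint ((fun c => c + u i) '' C) ((fun c => c + u j) '' C)) ∧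
      (⋃ j, (fun c => c + u j) '' C) = Set.univ := by
  classical
  generalize hT : ⌈(K : ℚ) / (M + 1)⌉₊ = T at hcard ⊢
  have hlt : ∀ s < T, s * (M + 1) < K := by
    intro s hs
    rw [← hT, Nat.lt_ceil, lt_div_iff₀ (by positivity)] at hs
    exact_mod_cast hs
  obtain ⟨S, D, hS, hSD, -, hrec⟩ := hloc.exists_redundant_coords T hlt
  have hdet : ∀ c ∈ C, ∀ c' ∈ C, (∀ x ∉ S, c x = c' x) → c = c' := by
    intro c hc c' hc' h
    have hD := hrec c hc c' hc' fun x _ hx => h x hx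
    funext x
    by_cases hx : x ∈ S
    · exact hD x (hSD hx)
    · exact h x hx
  let res : C → {x // x ∉ S} → F := fun c x => c.1 x
  have hinj : Function.Injective res := fun c c' h =>
    Subtype.ext (hdet c c.2 c' c'.2 fun x hx => congrFun h ⟨x, hx⟩)
  have hbij : Function.Bijective res := by
    rw [Fintype.bijective_iff_injective_and_card]
    refine ⟨hinj, ?_⟩
    rw [← Nat.card_eq_fintype_card, hcard, Fintype.card_fun, Fintype.card_subtype_compl,
      Fintype.card_fin, Fintype.card_coe, hS]
  let e : Fin (Fintype.card F ^ T) ≃ (S → F) :=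
    (Fintype.equivFinOfCardEq (by rw [Fintype.card_fun, Fintype.card_coe, hS])).symm
  let u : Fin (Fintype.card F ^ T) → Fin K → F := fun j x =>
    if h : x ∈ S then e j ⟨x, h⟩ else 0
  have hu : Function.Injective u := by
    intro i j hij
    apply e.injective
    funext x
    simpa [u] using congrFun hij x
  refine ⟨u, hu, ?_, ?_⟩
  · intro i j hij
    rw [Set.disjoint_left]
    rintro _ ⟨c, hc, rfl⟩ ⟨c', hc', h⟩
    have hcc : c' = c := hdet c' hc' c hc fun x hx => by
      simpa [u, hx] using congrFun h x
    subst hcc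
    exact hij (hu (add_left_cancel h)).symm
  · refine Set.eq_univ_of_forall fun v => ?_
    obtain ⟨c, hc⟩ := hbij.2 fun x => v x
    refine Set.mem_iUnion.2 ⟨e.symm fun x => v x - c.1 x, c.1, c.2, ?_⟩
    funext x
    by_cases hx : x ∈ S
    · simp [u, hx]
    · simpa [u, hx] using congrFun hc ⟨x, hx⟩
end

section
/- Let F_q be a finite field with q elements, K ≥ 1, M ≥ 1, and set T* = ⌈K/(M+1)⌉. Let C ⊆ F_q^K be a (possibly non-linear) code with locality M and with |C| = q^{K−T*} (an optimal LRC). Then there exists a function A : F_q^K → F_q^{T*} such that for every i ∈ {1,…,K} there exist a set R(i) ⊆ {1,…,K}\{i} with |R(i)| ≤ M and a function D_i : F_q^{T*} × F_q^{R(i)} → F_q satisfying D_i(A(x), x|_{R(i)}) = x_i for every x ∈ F_q^K. (That is, an optimal LRC yields a single-server PIR-SI code of length T* in which every message can be recovered from the answer together with M side-information symbols.) -/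
/-- In a code of locality `r` and length `n` one can greedily choose a set `S` of `t` coordinates
and a set `N ⊇ S` of at most `t * (r + 1)` coordinates such that the values of a codeword on
`N \ S` determine its values on `N`, provided that `s * (r + 1) < n` for all `s < t`. -/
theorem HasLocality.exists_redundant_coordinates {F : Type*} {n r : ℕ} {C : Set (Fin n → F)}
    (h : HasLocality C r) (t : ℕ) (ht : ∀ s < t, s * (r + 1) < n) :
    ∃ S N : Finset (Fin n), S ⊆ N ∧ S.card = t ∧ N.card ≤ t * (r + 1) ∧
      ∀ c ∈ C, ∀ d ∈ C, (∀ l ∈ N, l ∉ S → c l = d l) → ∀ l ∈ N, c l = d l := by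
  induction t with
  | zero => exact ⟨∅, ∅, by simp⟩
  | succ t ih =>
    obtain ⟨S, N, hSN, hS, hN, hdet⟩ := ih fun s hs => ht s (by omega)
    obtain ⟨i, hi⟩ : ∃ i, i ∉ N := by
      by_contra! hall
      have huniv : N = Finset.univ := Finset.eq_univ_iff_forall.2 hall
      have hlt := ht t (by omega)
      rw [huniv, Finset.card_univ, Fintype.card_fin] at hN
      omega
    obtain ⟨R, hiR, hR, g, hg⟩ := h i
    refine ⟨insert i S, insert i (N ∪ R), ?_, ?_, ?_, ?_⟩
    · exact Finset.insert_subset_insert i (hSN.trans Finset.subset_union_left)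
    · rw [Finset.card_insert_of_notMem fun hiS => hi (hSN hiS), hS]
    · have h₁ := Finset.card_insert_le i (N ∪ R)
      have h₂ := Finset.card_union_le N R
      rw [Nat.succ_mul]
      omega
    · intro c hc d hd hcd
      have hNeq : ∀ l ∈ N, c l = d l := hdet c hc d hd fun l hl hlS =>
        hcd l (by simp [hl]) (by
          rw [Finset.mem_insert, not_or]
          exact ⟨fun e => hi (e ▸ hl), hlS⟩)
      have hReq : ∀ l ∈ R, c l = d l := fun l hl => by
        by_cases hlS : l ∈ S
        · exact hNeq l (hSN hlS)
        · refine hcd l (by simp [hl]) ?_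
          rw [Finset.mem_insert, not_or]
          exact ⟨fun e => hiR (e ▸ hl), hlS⟩
      intro l hl
      rw [Finset.mem_insert, Finset.mem_union] at hl
      rcases hl with rfl | hl | hl
      · rw [← hg c hc, ← hg d hd]
        congr 1
        exact funext fun m => hReq m m.2
      · exact hNeq l hl
      · exact hReq l hl

/-- An optimal locally recoverable code is systematic: there are `⌈n / (r + 1)⌉` coordinates `S`
such that every word agrees with some codeword outside `S`. -/
theorem HasLocality.exists_systematic {F : Type*} [Fintype F] {n r : ℕ} {C : Set (Fin n → F)}
    (h : HasLocality C r)
    (hcard : Nat.card C = Fintype.card F ^ (n - ⌈(n : ℚ) / (r + 1)⌉₊)) :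
    ∃ S : Finset (Fin n), S.card = ⌈(n : ℚ) / (r + 1)⌉₊ ∧
      ∀ x : Fin n → F, ∃ c ∈ C, ∀ l ∉ S, c l = x l := by
  obtain ⟨S, N, hSN, hS, -, hdet⟩ :=
    h.exists_redundant_coordinates ⌈(n : ℚ) / (r + 1)⌉₊ fun s hs => by
      rw [Nat.lt_ceil, lt_div_iff₀ (by positivity)] at hs
      exact_mod_cast hs
  refine ⟨S, hS, ?_⟩
  let π : C → ({l // l ∉ S} → F) := fun c l => c.1 l
  have hinj : Function.Injective π := by
    rintro ⟨c, hc⟩ ⟨d, hd⟩ hcd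
    have hoff : ∀ l ∉ S, c l = d l := fun l hl => congrFun hcd ⟨l, hl⟩
    have hN := hdet c hc d hd fun l _ => hoff l
    ext l
    by_cases hl : l ∈ S
    · exact hN l (hSN hl)
    · exact hoff l hl
  have hbij : Function.Bijective π := by
    refine hinj.bijective_of_nat_card_le ?_
    rw [hcard, ← hS]
    simp [Nat.card_eq_fintype_card, Fintype.card_subtype_compl]
  intro x
  obtain ⟨c, hc⟩ := hbij.2 fun l => x l
  exact ⟨c, c.2, fun l hl => congrFun hc ⟨l, hl⟩⟩

/-- Theorem 9: an optimal LRC `C ⊆ F_q^K` with locality `M` (of maximum possible size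
`q^(K - T*)`, with `T* = ⌈K/(M+1)⌉`) yields a single-server PIR-SI code of length `T*`:
an answer function `A : F_q^K → F_q^(T*)` such that every message `x i` can be recovered
from the answer `A x` together with at most `M` side-information symbols. -/
theorem optimalLRC_gives_pirSiCode {F : Type*} [Field F] [Fintype F] {K M : ℕ}
    (hK : 1 ≤ K) (hM : 1 ≤ M)
    (C : Set (Fin K → F)) (hloc : HasLocality C M)
    (hcard : Nat.card C = Fintype.card F ^ (K - ⌈(K : ℚ) / (M + 1)⌉₊)) :
    ∃ A : (Fin K → F) → (Fin ⌈(K : ℚ) / (M + 1)⌉₊ → F),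
      ∀ i : Fin K, ∃ R : Finset (Fin K), i ∉ R ∧ R.card ≤ M ∧
        ∃ D : (Fin ⌈(K : ℚ) / (M + 1)⌉₊ → F) → ({x : Fin K // x ∈ R} → F) → F,
          ∀ x : Fin K → F, D (A x) (fun l => x l.val) = x i := by
  classical
  obtain ⟨S, hS, hsys⟩ := hloc.exists_systematic hcard
  choose φ hφC hφ using hsys
  let e : Fin ⌈(K : ℚ) / (M + 1)⌉₊ ≃ S := (Fintype.equivFinOfCardEq (by simpa using hS)).symm
  let v : (Fin ⌈(K : ℚ) / (M + 1)⌉₊ → F) → Fin K → F := fun a l =>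
    if h : l ∈ S then a (e.symm ⟨l, h⟩) else 0
  let A : (Fin K → F) → (Fin ⌈(K : ℚ) / (M + 1)⌉₊ → F) := fun x j => x (e j) - φ x (e j)
  have hA : ∀ x l, v (A x) l = x l - φ x l := by
    intro x l
    by_cases h : l ∈ S
    · simp [v, A, h]
    · simp [v, h, hφ x l h]
  refine ⟨A, fun i => ?_⟩
  obtain ⟨R, hiR, hR, g, hg⟩ := hloc i
  refine ⟨R, hiR, hR, fun a y => g (fun l => y l - v a l) + v a i, fun x => ?_⟩
  simp only [hA, sub_sub_cancel]
  rw [hg _ (hφC x), add_sub_cancel]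
end

section
/- Let F_q be a finite field with q elements and let A : F_q^K → F_q^T be a function such that for every i ∈ {1,…,K} there exist a set S_i ⊆ {1,…,K}\{i} with |S_i| ≤ M and a function D_i : F_q^T × F_q^{S_i} → F_q satisfying D_i(A(x), x|_{S_i}) = x_i for every x ∈ F_q^K. Then there exists a set C ⊆ F_q^K with |C| ≥ q^{K−T} that has locality M: for every i ∈ {1,…,K} there exist a set R(i) ⊆ {1,…,K}\{i} with |R(i)| ≤ M and a function g_i : F_q^{R(i)} → F_q such that c_i = g_i(c|_{R(i)}) for every c ∈ C. (Given a PIR-SI code of length T over F_q, one can construct an LRC of size at least q^{K−T}.) -/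
/-- Some fibre of a map `F^K → F^T` over a finite nonempty alphabet has at least
`|F|^(K - T)` elements (also when `K < T`, where this says that it is nonempty). -/
theorem exists_card_pow_sub_le_card_fiber {F : Type*} [Fintype F] [Nonempty F] {K T : ℕ}
    (A : (Fin K → F) → (Fin T → F)) :
    ∃ y, Fintype.card F ^ (K - T) ≤ Nat.card {x | A x = y} := by
  classical
  rcases le_total T K with h | h
  · obtain ⟨y, hy⟩ := Fintype.exists_le_card_fiber_of_mul_le_card A
      (n := Fintype.card F ^ (K - T)) (by simp [← pow_add, Nat.add_sub_cancel' h])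
    refine ⟨y, hy.trans_eq ?_⟩
    rw [Set.coe_ofPred, Nat.card_eq_fintype_card, Fintype.card_subtype]
  · obtain ⟨x⟩ : Nonempty (Fin K → F) := inferInstance
    have : Nonempty {z | A z = A x} := ⟨⟨x, rfl⟩⟩
    exact ⟨A x, by simpa [Nat.sub_eq_zero_of_le h] using Nat.card_pos (α := {z | A z = A x})⟩

/-- Theorem 7: given a (possibly non-linear) single-message PIR-SI code of length `T`
over `F_q` (an answer function `A` from which every message is recoverable together with
at most `M` side-information symbols), one can construct an LRC `C ⊆ F_q^K` with
locality `M` of size at least `q^(K - T)`. -/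
theorem pirSiCode_gives_LRC {F : Type*} [Field F] [Fintype F] {K T M : ℕ}
    (A : (Fin K → F) → (Fin T → F))
    (hA : ∀ i : Fin K, ∃ S : Finset (Fin K), i ∉ S ∧ S.card ≤ M ∧
      ∃ D : (Fin T → F) → ({x : Fin K // x ∈ S} → F) → F,
        ∀ x : Fin K → F, D (A x) (fun l => x l.val) = x i) :
    ∃ C : Set (Fin K → F),
      Fintype.card F ^ (K - T) ≤ Nat.card C ∧ HasLocality C M := by
  obtain ⟨y, hy⟩ := exists_card_pow_sub_le_card_fiber A
  refine ⟨{x | A x = y}, hy, fun i => ?_⟩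
  obtain ⟨S, hiS, hS, D, hD⟩ := hA i
  exact ⟨S, hiS, hS, D y, fun c (hc : A c = y) => hc ▸ hD c⟩
end

section
/- Let F_q be a finite field with q elements, K ≥ 1, M ≥ 1, and let A : F_q^K → F_q^T be a function such that for every i ∈ {1,…,K} there exist a set S_i ⊆ {1,…,K}\{i} with |S_i| ≤ M and a function D_i : F_q^T × F_q^{S_i} → F_q satisfying D_i(A(x), x|_{S_i}) = x_i for every x ∈ F_q^K. Then T ≥ ⌈K/(M+1)⌉. (Even allowing arbitrary non-linear answer functions, any single-server single-message PIR-SI scheme with side-information size M must download at least ⌈K/(M+1)⌉ symbols.) -/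
/-- If every coordinate is a function of `A x` and at most `M` other coordinates, then for each
`n ≤ K` some set `P` of at least `n` coordinates is determined by `A x` and a subset `J ⊆ P`, where
the number `t` of saved coordinates satisfies `P.card ≤ t * (M + 1)`. -/
theorem exists_determining_subset {F B : Type*} {K M : ℕ} (A : (Fin K → F) → B)
    (hA : ∀ i : Fin K, ∃ S : Finset (Fin K), i ∉ S ∧ S.card ≤ M ∧
      ∀ x y : Fin K → F, A x = A y → (∀ l ∈ S, x l = y l) → x i = y i)
    (n : ℕ) (hn : n ≤ K) :
    ∃ (t : ℕ) (P J : Finset (Fin K)), n ≤ P.card ∧ J ⊆ P ∧ J.card + t = P.card ∧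
      P.card ≤ t * (M + 1) ∧
      ∀ x y : Fin K → F, A x = A y → (∀ l ∈ J, x l = y l) → ∀ l ∈ P, x l = y l := by
  induction n with
  | zero => exact ⟨0, ∅, ∅, by simp⟩
  | succ n ih =>
    obtain ⟨t, P, J, hnP, hJP, hJt, hPt, hdet⟩ := ih (by omega)
    by_cases hlt : n + 1 ≤ P.card
    · exact ⟨t, P, J, hlt, hJP, hJt, hPt, hdet⟩
    obtain ⟨i, hi⟩ : ∃ i, i ∉ P := by
      by_contra! h
      have : P.card = K := by simp [Finset.eq_univ_iff_forall.2 h]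
      omega
    obtain ⟨S, hiS, hSM, hS⟩ := hA i
    have hPS : (P ∪ S \ P).card = P.card + (S \ P).card :=
      Finset.card_union_of_disjoint Finset.disjoint_sdiff
    have hJS : (J ∪ S \ P).card = J.card + (S \ P).card :=
      Finset.card_union_of_disjoint (Finset.disjoint_sdiff.mono_left hJP)
    have hiPS : i ∉ P ∪ S \ P := by simp [hi, hiS]
    have hcard : (insert i (P ∪ S \ P)).card = P.card + (S \ P).card + 1 := by
      rw [Finset.card_insert_of_notMem hiPS, hPS]
    have hSP : (S \ P).card ≤ M := (Finset.card_le_card Finset.sdiff_subset).trans hSM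
    refine ⟨t + 1, insert i (P ∪ S \ P), J ∪ S \ P, by omega, ?_, by omega, ?_, ?_⟩
    · exact (Finset.union_subset_union_left hJP).trans (Finset.subset_insert _ _)
    · rw [hcard, add_one_mul]
      omega
    · intro x y hxy hJ
      have hP : ∀ l ∈ P, x l = y l :=
        hdet x y hxy fun l hl => hJ l (Finset.mem_union_left _ hl)
      have hU : ∀ l ∈ P ∪ S \ P, x l = y l := by
        intro l hl
        rcases Finset.mem_union.1 hl with h | h
        · exact hP l h
        · exact hJ l (Finset.mem_union_right _ h)
      intro l hl
      rcases Finset.mem_insert.1 hl with rfl | h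
      · exact hS x y hxy fun l hl => hU l (by simp [hl])
      · exact hU l h

/-- Non-linear converse bound: even allowing arbitrary (non-linear) answer functions, any
single-server single-message PIR-SI scheme over `F_q` with `K` messages and
side-information size `M` must download at least `⌈K/(M+1)⌉` symbols. The hypothesis on
`A` is the necessary recoverability condition imposed by `W`-privacy: every message index
is recoverable from the answer together with some side-information set of size at most
`M`. -/
theorem pirSiCode_length_lower_bound {F : Type*} [Field F] [Fintype F] {K T M : ℕ}
    (hK : 1 ≤ K) (hM : 1 ≤ M)
    (A : (Fin K → F) → (Fin T → F))
    (hA : ∀ i : Fin K, ∃ S : Finset (Fin K), i ∉ S ∧ S.card ≤ M ∧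
      ∃ D : (Fin T → F) → ({x : Fin K // x ∈ S} → F) → F,
        ∀ x : Fin K → F, D (A x) (fun l => x l.val) = x i) :
    ⌈(K : ℚ) / (M + 1)⌉₊ ≤ T := by
  obtain ⟨t, P, J, hKP, -, hJt, hPt, hdet⟩ := exists_determining_subset (M := M) A (by
    intro i
    obtain ⟨S, hiS, hSM, D, hD⟩ := hA i
    refine ⟨S, hiS, hSM, fun x y hxy h => ?_⟩
    rw [← hD x, ← hD y, hxy]
    congr 1
    exact funext fun l => h l.1 l.2) K le_rfl
  have hPuniv : P = Finset.univ :=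
    Finset.eq_univ_of_card P (le_antisymm (Finset.card_le_univ P) (by simpa using hKP))
  have hPK : P.card = K := by simp [hPuniv]
  have hinj : Function.Injective
      (fun x : Fin K → F => (A x, fun l : {l : Fin K // l ∈ J} => x l.1)) := by
    intro x y hxy
    obtain ⟨hAxy, hJxy⟩ := Prod.mk.inj hxy
    exact funext fun l => hdet x y hAxy (fun l hl => congrFun hJxy ⟨l, hl⟩) l (by simp [hPuniv])
  have hcard := Nat.card_le_card_of_injective _ hinj
  rw [Nat.card_prod, Nat.card_fun, Nat.card_fun, Nat.card_fun, ← pow_add] at hcard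
  have hle := (Nat.pow_le_pow_iff_right (Finite.one_lt_card (α := F))).1 hcard
  simp only [Nat.card_eq_fintype_card, Fintype.card_fin, Fintype.card_coe] at hle
  have hKT : K ≤ T * (M + 1) := by
    calc K ≤ t * (M + 1) := hPK ▸ hPt
      _ ≤ T * (M + 1) := Nat.mul_le_mul_right _ (by omega)
  rw [Nat.ceil_le, div_le_iff₀ (by positivity)]
  exact_mod_cast hKT
end
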